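/- arXiv:2002.11383 — 12 statements merged into one kernel-verified Lean document; each statement's English description precedes it below -/
import Mathlib

section
/- Let K, F, t, k be positive integers with k ≤ K, and let U_1, …, U_K be subsets of {1, …, F} such that every element j ∈ {1, …, F} belongs to exactly t of the sets U_1, …, U_K. Then the sum, over all k-element subsets {d_1, …, d_k} of {1, …, K}, of |U_{d_1} ∪ ⋯ ∪ U_{d_k}| equals F·(C(K,k) − C(K−t,k)), where C(·,·) denotes the binomial coefficient (with C(m,r) = 0 when r > m). -/
/-- The number of `k`-element subsets of a finite type that meet a given finset `S`. -/
theorem card_filter_powersetCard_not_disjoint {α : Type*} [Fintype α] [DecidableEq α]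
    (S : Finset α) (k : ℕ) :
    ((Finset.powersetCard k (Finset.univ : Finset α)).filter (fun D => ¬ Disjoint D S)).card
      = (Fintype.card α).choose k - (Fintype.card α - S.card).choose k := by
  have h_disjoint : (Finset.powersetCard k (Finset.univ : Finset α)).filter
      (fun D => Disjoint D S) = Finset.powersetCard k Sᶜ := by
    ext D
    simp [Finset.mem_powersetCard, Finset.subset_compl_iff_disjoint_right, and_comm]
  have h_add := Finset.card_filter_add_card_filter_not
    (s := Finset.powersetCard k (Finset.univ : Finset α)) (fun D => Disjoint D S)
  rw [h_disjoint, Finset.card_powersetCard, Finset.card_powersetCard, Finset.card_compl,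
    Finset.card_univ] at h_add
  omega

/-- If `U_1, …, U_K ⊆ {1, …, F}` have constant degree `t` (every `j` lies in exactly `t`
of the sets), then the sum over all `k`-element subsets `D` of `{1, …, K}` of
`|⋃_{i ∈ D} U_i|` equals `F·(C(K,k) − C(K−t,k))`. -/
theorem stmt_0 (K F t k : ℕ) (hK : 0 < K) (hF : 0 < F) (ht : 0 < t) (hk : 0 < k)
    (hkK : k ≤ K) (U : Fin K → Finset (Fin F))
    (hdeg : ∀ j : Fin F, (Finset.univ.filter (fun i => j ∈ U i)).card = t) :
    ∑ D ∈ Finset.powersetCard k (Finset.univ : Finset (Fin K)), (D.biUnion U).card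
      = F * (Nat.choose K k - Nat.choose (K - t) k) := by
  have h_count : ∀ j : Fin F,
      ((Finset.powersetCard k (Finset.univ : Finset (Fin K))).filter
        (fun D => j ∈ D.biUnion U)).card = Nat.choose K k - Nat.choose (K - t) k := by
    intro j
    have h_meet := card_filter_powersetCard_not_disjoint
      (Finset.univ.filter (fun i => j ∈ U i)) k
    rw [hdeg j, Fintype.card_fin] at h_meet
    rw [← h_meet]
    congr 1
    ext D
    simp [Finset.not_disjoint_iff]
  calc ∑ D ∈ Finset.powersetCard k (Finset.univ : Finset (Fin K)), (D.biUnion U).card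
      = ∑ D ∈ Finset.powersetCard k (Finset.univ : Finset (Fin K)),
          ∑ j : Fin F, if j ∈ D.biUnion U then 1 else 0 := by
        refine Finset.sum_congr rfl fun D _ => ?_
        rw [← Finset.card_filter, Finset.filter_univ_mem]
    _ = F * (Nat.choose K k - Nat.choose (K - t) k) := by
        rw [Finset.sum_comm]
        simp_rw [← Finset.card_filter, h_count]
        simp
end

section
/- Let K and N be positive integers with N ≤ K, let X be a finite set, and let U_1, …, U_K be subsets of X, all of the same cardinality. Suppose that the sum S_{(d_1,…,d_N)} = Σ_{k=1}^{N} |U_{d_1} ∪ U_{d_2} ∪ ⋯ ∪ U_{d_k}| takes the same value for every ordered N-tuple (d_1, …, d_N) of distinct elements of {1, …, K}. Then for every k ∈ {1, …, N}, the cardinality |∪_{i ∈ I} U_i| takes the same value for all k-element subsets I of {1, …, K}. -/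
/-- A function on finsets that is invariant under exchanging one element, on sets of cardinality
`k`, is constant on sets of cardinality `k`. -/
theorem Finset.eq_of_exchange {α β : Type*} [DecidableEq α] {f : Finset α → β} {k : ℕ}
    (hf : ∀ (A : Finset α) (a b : α), A.card + 1 = k → a ∉ A → b ∉ A → a ≠ b →
      f (insert a A) = f (insert b A)) (I J : Finset α) (hI : I.card = k) (hJ : J.card = k) :
    f I = f J := by
  induction h : (I \ J).card generalizing I with
  | zero =>
    rw [Finset.card_eq_zero, Finset.sdiff_eq_empty_iff_subset] at h
    rw [Finset.eq_of_subset_of_card_le h (by omega)]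
  | succ n ih =>
    obtain ⟨a, ha⟩ : (I \ J).Nonempty := Finset.card_pos.1 (by omega)
    have hsymm : (J \ I).card = (I \ J).card := Finset.card_sdiff_comm (by omega)
    obtain ⟨b, hb⟩ : (J \ I).Nonempty := Finset.card_pos.1 (by omega)
    obtain ⟨haI, haJ⟩ := Finset.mem_sdiff.1 ha
    obtain ⟨hbJ, hbI⟩ := Finset.mem_sdiff.1 hb
    have hbA : b ∉ I.erase a := fun hmem => hbI (Finset.mem_of_mem_erase hmem)
    have hA : (I.erase a).card + 1 = k := by rw [Finset.card_erase_add_one haI, hI]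
    have hexch := hf (I.erase a) a b hA (Finset.notMem_erase a I) hbA
      (fun hab => haJ (hab ▸ hbJ))
    rw [Finset.insert_erase haI] at hexch
    rw [hexch]
    refine ih _ (by rw [Finset.card_insert_of_notMem hbA, hA]) ?_
    rw [Finset.insert_sdiff_of_mem _ hbJ, Finset.erase_sdiff_comm, Finset.card_erase_of_mem ha, h,
      Nat.add_sub_cancel]

theorem List.toFinset_take_swap {α : Type*} [DecidableEq α] (l r : List α) (a b : α) {j : ℕ}
    (hj : j ≠ l.length + 1) :
    ((l ++ a :: b :: r).take j).toFinset = ((l ++ b :: a :: r).take j).toFinset := by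
  rcases Nat.lt_or_gt_of_ne hj with h | h
  · rw [List.take_append_of_le_length (by omega), List.take_append_of_le_length (by omega)]
  · obtain ⟨m, rfl⟩ : ∃ m, j = l.length + (m + 2) := ⟨j - l.length - 2, by omega⟩
    ext x
    simp only [List.take_length_add_append, List.take_succ_cons, List.mem_toFinset,
      List.mem_append, List.mem_cons]
    tauto

theorem List.biUnion_Iic_getElem {α β : Type*} [DecidableEq α] [DecidableEq β] (l : List α)
    {N : ℕ} (hN : N ≤ l.length) (U : α → Finset β) (k : Fin N) :
    ((Finset.Iic k).biUnion fun i : Fin N => U (l[(i : ℕ)]'(i.isLt.trans_le hN))) =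
      (l.take (k + 1)).toFinset.biUnion U := by
  ext x
  simp only [Finset.mem_biUnion, Finset.mem_Iic, List.mem_toFinset, List.mem_take_iff_getElem]
  constructor
  · rintro ⟨i, hi, hx⟩
    have hik : (i : ℕ) ≤ k := hi
    exact ⟨_, ⟨i, by omega, rfl⟩, hx⟩
  · rintro ⟨_, ⟨i, hi, rfl⟩, hx⟩
    exact ⟨⟨i, by omega⟩, Fin.le_def.2 (by simp only; omega), hx⟩


/-- If all `U_i` have the same cardinality and the telescoping union sum
`S_{(d_1,…,d_N)} = Σ_{k=1}^N |U_{d_1} ∪ ⋯ ∪ U_{d_k}|` is the same for every ordered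
`N`-tuple of distinct indices, then for every `k ∈ {1,…,N}` all unions of `k` of the
sets have the same cardinality. -/
theorem stmt_2 (K N : ℕ) (hK : 0 < K) (hN : 0 < N) (hNK : N ≤ K)
    {X : Type*} [Fintype X] [DecidableEq X] (U : Fin K → Finset X)
    (hcard : ∀ i j : Fin K, (U i).card = (U j).card)
    (hS : ∀ d d' : Fin N → Fin K, Function.Injective d → Function.Injective d' →
      (∑ k : Fin N, ((Finset.Iic k).biUnion fun i => U (d i)).card) =
      (∑ k : Fin N, ((Finset.Iic k).biUnion fun i => U (d' i)).card)) :
    ∀ k : ℕ, 1 ≤ k → k ≤ N → ∀ I J : Finset (Fin K), I.card = k → J.card = k →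
      (I.biUnion U).card = (J.biUnion U).card := by
  have hlist : ∀ l l' : List (Fin K), l.Nodup → l'.Nodup → N ≤ l.length → N ≤ l'.length →
      (∑ k : Fin N, ((l.take (k + 1)).toFinset.biUnion U).card) =
        ∑ k : Fin N, ((l'.take (k + 1)).toFinset.biUnion U).card := by
    intro l l' hl hl' hlen hlen'
    have h := hS (fun i => l[(i : ℕ)]'(i.isLt.trans_le hlen))
      (fun i => l'[(i : ℕ)]'(i.isLt.trans_le hlen'))
      (fun i j hij => Fin.ext ((hl.getElem_inj_iff).1 hij))
      (fun i j hij => Fin.ext ((hl'.getElem_inj_iff).1 hij))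
    simpa only [l.biUnion_Iic_getElem hlen, l'.biUnion_Iic_getElem hlen'] using h
  intro k hk hkN I J hI hJ
  refine Finset.eq_of_exchange (f := fun I => (I.biUnion U).card) ?_ I J hI hJ
  intro A a b hA ha hb hab
  let r := (insert a (insert b A))ᶜ.toList
  have hnodup : (A.toList ++ a :: b :: r).Nodup := by
    simp only [r, List.nodup_append, List.nodup_cons, Finset.nodup_toList, List.mem_cons,
      Finset.mem_toList, Finset.mem_compl, Finset.mem_insert]
    grind
  have hperm : (A.toList ++ a :: b :: r).Perm (A.toList ++ b :: a :: r) :=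
    (List.Perm.swap b a r).append_left _
  have hlen : N ≤ (A.toList ++ a :: b :: r).length := by
    have hc := Finset.card_add_card_compl (insert a (insert b A))
    rw [Finset.card_insert_of_notMem (by simp [hab, ha]), Finset.card_insert_of_notMem hb,
      Fintype.card_fin] at hc
    simp only [r, List.length_append, List.length_cons, Finset.length_toList]
    omega
  have hsum := hlist _ _ hnodup (hperm.nodup_iff.1 hnodup) hlen (hperm.length_eq ▸ hlen)
  let p : Fin N := ⟨A.card, by omega⟩
  rw [← Finset.add_sum_erase _ _ (Finset.mem_univ p),
    ← Finset.add_sum_erase (a := p) _ _ (Finset.mem_univ p)] at hsum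
  have hrest : ∀ j ∈ Finset.univ.erase p,
      (((A.toList ++ a :: b :: r).take (j + 1)).toFinset.biUnion U).card =
        (((A.toList ++ b :: a :: r).take (j + 1)).toFinset.biUnion U).card := by
    intro j hj
    rw [List.toFinset_take_swap]
    intro hjp
    refine Finset.ne_of_mem_erase hj (Fin.ext ?_)
    simpa using hjp
  rw [Finset.sum_congr rfl hrest] at hsum
  have htake : ∀ (x : Fin K) (s : List (Fin K)),
      ((A.toList ++ x :: s).take (p + 1)).toFinset = insert x A := by
    intro x s
    have hp : (p : ℕ) + 1 = A.toList.length + 1 := by simp [p]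
    rw [hp, List.take_length_add_append]
    ext y
    simp
  simpa only [htake] using Nat.add_right_cancel hsum
end

section
/- Let K and N be positive integers with N ≤ K, let X be a finite set, and let U_1, …, U_K be subsets of X. Suppose that for every k ∈ {1, …, N}, the cardinality |∪_{i ∈ I} U_i| takes the same value for all k-element subsets I of {1, …, K}. Then for every k ∈ {1, …, N}, the cardinality |∩_{i ∈ I} U_i| also takes the same value for all k-element subsets I of {1, …, K}. -/
open Finset in
/-- The cardinality of an intersection as an alternating sum over complements of unions. -/
theorem card_inf_eq_sum_card_compl_biUnion {ι X : Type*} [DecidableEq ι] [Fintype X]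
    [DecidableEq X] (U : ι → Finset X) (I : Finset ι) :
    (#(I.inf U) : ℤ) = ∑ t ∈ I.powerset, (-1 : ℤ) ^ #t * #(t.biUnion U)ᶜ := by
  have h := inclusion_exclusion_card_inf_compl I fun i ↦ (U i)ᶜ
  simpa only [compl_compl, ← Finset.compl_sup, sup_eq_biUnion] using h

open Finset in
/-- If `f` depends only on the cardinality for sets of at most `N` elements, then so does the sum
of `f` over the subsets of such a set. -/
theorem sum_powerset_eq_of_card_eq {ι M : Type*} [AddCommMonoid M] (N : ℕ) (f : Finset ι → M)
    (hf : ∀ s t : Finset ι, #s ≤ N → #s = #t → f s = f t) {I J : Finset ι}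
    (hI : #I ≤ N) (hIJ : #I = #J) :
    ∑ t ∈ I.powerset, f t = ∑ t ∈ J.powerset, f t := by
  classical
  let g : ℕ → M := fun n ↦ if h : ∃ t : Finset ι, #t = n then f h.choose else 0
  have hg (s : Finset ι) (hs : #s ≤ N) : f s = g #s := by
    have h : ∃ t : Finset ι, #t = #s := ⟨s, rfl⟩
    simp only [g, dif_pos h]
    exact hf _ _ hs h.choose_spec.symm
  have key (A : Finset ι) (hA : #A ≤ N) :
      ∑ t ∈ A.powerset, f t = ∑ m ∈ range (#A + 1), (#A).choose m • g m := by
    rw [← sum_powerset_apply_card]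
    exact sum_congr rfl fun t ht ↦ hg t ((card_le_card (mem_powerset.1 ht)).trans hA)
  rw [key I hI, key J (hIJ ▸ hI), hIJ]

/-- If for every `k ∈ {1,…,N}` all unions of `k` of the sets `U_1, …, U_K` have the same
cardinality, then for every `k ∈ {1,…,N}` all intersections of `k` of the sets also
have the same cardinality. -/
theorem stmt_3 (K N : ℕ) (hK : 0 < K) (hN : 0 < N) (hNK : N ≤ K)
    {X : Type*} [Fintype X] [DecidableEq X] (U : Fin K → Finset X)
    (hU : ∀ k : ℕ, 1 ≤ k → k ≤ N → ∀ I J : Finset (Fin K), I.card = k → J.card = k →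
      (I.biUnion U).card = (J.biUnion U).card) :
    ∀ k : ℕ, 1 ≤ k → k ≤ N → ∀ I J : Finset (Fin K), I.card = k → J.card = k →
      (I.inf U).card = (J.inf U).card := by
  intro k _ hkN I J hI hJ
  zify
  rw [card_inf_eq_sum_card_compl_biUnion, card_inf_eq_sum_card_compl_biUnion]
  refine sum_powerset_eq_of_card_eq N _ (fun s t hs hst ↦ ?_) (hI ▸ hkN) (hI.trans hJ.symm)
  have hcard : (s.biUnion U).card = (t.biUnion U).card := by
    obtain rfl | hne := s.eq_empty_or_nonempty
    · rw [Finset.card_eq_zero.1 (hst.symm.trans Finset.card_empty)]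
    · exact hU _ hne.card_pos hs s t rfl hst.symm
  rw [hst, Finset.card_compl, Finset.card_compl, hcard]
end

section
/- Let K, N, F, t be positive integers with t ≤ N ≤ K. Let U_1, …, U_K be subsets of {1, …, F}, all of the same cardinality, such that every element j ∈ {1, …, F} belongs to exactly t of the sets U_1, …, U_K. Suppose that the sum S_{(d_1,…,d_N)} = Σ_{k=1}^{N} |U_{d_1} ∪ U_{d_2} ∪ ⋯ ∪ U_{d_k}| takes the same value for every ordered N-tuple (d_1, …, d_N) of distinct elements of {1, …, K}. Then the binomial coefficient C(K,t) divides F. -/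
/-- If the sum of `f` over the initial segments of an ordering of `Fin (n + 1)`, of sizes
`1, …, N`, does not depend on the ordering, then `f A` depends only on `A.card` as long as
`A.card ≤ N`. -/
theorem Finset.eq_of_sum_initial_segments_eq {n N : ℕ}
    (f : Finset (Fin (n + 1)) → ℕ)
    (h : ∀ σ τ : Equiv.Perm (Fin (n + 1)),
      ∑ k ∈ Finset.range N, f ((Finset.univ.filter (fun i => i.val < k + 1)).map σ.toEmbedding) =
      ∑ k ∈ Finset.range N, f ((Finset.univ.filter (fun i => i.val < k + 1)).map τ.toEmbedding))
    {A B : Finset (Fin (n + 1))} (hAB : A.card = B.card) (hA : A.card ≤ N) : f A = f B := by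
  have map_swap (σ : Equiv.Perm (Fin (n + 1))) (i : Fin n) (k : ℕ) (hik : i.val + 1 ≠ k) :
      (Finset.univ.filter (fun j : Fin (n + 1) => j.val < k)).map
        (σ * Equiv.swap i.castSucc i.succ).toEmbedding =
      (Finset.univ.filter (fun j : Fin (n + 1) => j.val < k)).map σ.toEmbedding := by
    have hs : (Finset.univ.filter (fun j : Fin (n + 1) => j.val < k)).map
        (Equiv.swap i.castSucc i.succ).toEmbedding =
        Finset.univ.filter (fun j : Fin (n + 1) => j.val < k) := by
      ext x
      simp only [Finset.mem_map_equiv, Equiv.symm_swap, Finset.mem_filter, Finset.mem_univ,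
        true_and]
      rw [Equiv.swap_apply_def]
      split_ifs with h1 h2
      · subst h1; simp; omega
      · subst h2; simp; omega
      · rfl
    conv_rhs => rw [← hs, Finset.map_map]
    rfl
  have swap_invariant (σ : Equiv.Perm (Fin (n + 1))) (i : Fin n) (k : ℕ) (hk : k ≤ N) :
      f ((Finset.univ.filter (fun j : Fin (n + 1) => j.val < k)).map
        (σ * Equiv.swap i.castSucc i.succ).toEmbedding) =
      f ((Finset.univ.filter (fun j : Fin (n + 1) => j.val < k)).map σ.toEmbedding) := by
    by_cases hik : i.val + 1 = k
    · subst hik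
      have := h (σ * Equiv.swap i.castSucc i.succ) σ
      have hmem : i.val ∈ Finset.range N := by simp; omega
      rw [← Finset.add_sum_erase _ _ hmem, ← Finset.add_sum_erase _ _ hmem] at this
      rw [Finset.sum_congr rfl fun k hk => by
        rw [map_swap σ i (k + 1) (by have := Finset.ne_of_mem_erase hk; omega)]] at this
      exact Nat.add_right_cancel this
    · rw [map_swap σ i k hik]
  have perm_invariant (τ : Equiv.Perm (Fin (n + 1))) (k : ℕ) (hk : k ≤ N) :
      ∀ σ : Equiv.Perm (Fin (n + 1)),
      f ((Finset.univ.filter (fun j : Fin (n + 1) => j.val < k)).map (σ * τ).toEmbedding) =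
      f ((Finset.univ.filter (fun j : Fin (n + 1) => j.val < k)).map σ.toEmbedding) := by
    have hτ : τ ∈ Submonoid.closure
        (Set.range fun i : Fin n => Equiv.swap i.castSucc i.succ) := by
      rw [Equiv.Perm.mclosure_swap_castSucc_succ]; trivial
    induction hτ using Submonoid.closure_induction with
    | mem x hx =>
      obtain ⟨i, rfl⟩ := hx
      exact fun σ => swap_invariant σ i k hk
    | one => simp
    | mul x y _ _ hx hy => intro σ; rw [← mul_assoc, hy, hx]
  have exists_perm (C : Finset (Fin (n + 1))) : ∃ σ : Equiv.Perm (Fin (n + 1)),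
      (Finset.univ.filter (fun j : Fin (n + 1) => j.val < C.card)).map σ.toEmbedding = C := by
    have hC : C.card ≤ n + 1 := by simpa using C.card_le_univ
    have hcard : (Finset.univ.filter (fun j : Fin (n + 1) => j.val < C.card)).card = C.card := by
      rw [Fin.card_filter_val_lt]; omega
    let e := Finset.equivOfCardEq hcard
    refine ⟨(e.extendSubtype : Equiv.Perm _), Finset.eq_of_subset_of_card_le ?_ (by simp [hcard])⟩
    intro x hx
    obtain ⟨y, hy, rfl⟩ := Finset.mem_map.1 hx
    exact e.extendSubtype_mem y hy
  obtain ⟨σ, hσ⟩ := exists_perm A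
  obtain ⟨τ, hτ⟩ := exists_perm B
  have h1 := perm_invariant σ A.card hA 1
  have h2 := perm_invariant τ A.card hA 1
  rw [one_mul] at h1 h2
  rw [← hσ, ← hτ, ← hAB, h1, h2]

/-- If the number of points missed by all sets indexed by `B` depends only on `B.card ≤ N`, then
so does the number of points lying in all sets indexed by `A` and missed by all those indexed
by `B`, for disjoint `A` and `B` with `A.card + B.card ≤ N`. -/
theorem Finset.card_filter_mem_notMem_eq {ι α : Type*} [DecidableEq ι] [Fintype α]
    [DecidableEq α] (U : ι → Finset α) (N : ℕ)
    (h : ∀ B B' : Finset ι, B.card = B'.card → B.card ≤ N →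
      (Finset.univ.filter (fun j => ∀ i ∈ B, j ∉ U i)).card =
      (Finset.univ.filter (fun j => ∀ i ∈ B', j ∉ U i)).card)
    {A A' B B' : Finset ι} (hA : A.card = A'.card) (hB : B.card = B'.card)
    (hAB : Disjoint A B) (hAB' : Disjoint A' B') (hN : A.card + B.card ≤ N) :
    (Finset.univ.filter (fun j => (∀ i ∈ A, j ∈ U i) ∧ ∀ i ∈ B, j ∉ U i)).card =
    (Finset.univ.filter (fun j => (∀ i ∈ A', j ∈ U i) ∧ ∀ i ∈ B', j ∉ U i)).card := by
  have split (a : ι) (A B : Finset ι) :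
      (Finset.univ.filter (fun j => (∀ i ∈ A, j ∈ U i) ∧ ∀ i ∈ B, j ∉ U i)).card =
      (Finset.univ.filter (fun j => (∀ i ∈ insert a A, j ∈ U i) ∧ ∀ i ∈ B, j ∉ U i)).card +
      (Finset.univ.filter (fun j => (∀ i ∈ A, j ∈ U i) ∧ ∀ i ∈ insert a B, j ∉ U i)).card := by
    rw [← Finset.card_filter_add_card_filter_not (fun j => j ∈ U a), Finset.filter_filter,
      Finset.filter_filter]
    congr 2 <;> ext j <;> simp only [Finset.mem_filter, Finset.mem_univ, Finset.forall_mem_insert]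
      <;> tauto
  induction A using Finset.induction_on generalizing A' B B' with
  | empty =>
    obtain rfl : A' = ∅ := by simpa using hA.symm
    simpa using h B B' hB (by simpa using hN)
  | insert a A ha ih =>
    rw [Finset.card_insert_of_notMem ha] at hA hN
    obtain ⟨b, hb⟩ : A'.Nonempty := Finset.card_pos.1 (by omega)
    obtain ⟨A', hbA, rfl⟩ : ∃ C, b ∉ C ∧ insert b C = A' :=
      ⟨A'.erase b, by simp, Finset.insert_erase hb⟩
    rw [Finset.card_insert_of_notMem hbA] at hA
    rw [Finset.disjoint_insert_left] at hAB hAB'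
    have h1 := ih (by omega) hB hAB.2 hAB'.2 (by omega)
    have h2 := ih (A' := A') (B := insert a B) (B' := insert b B') (by omega)
      (by rw [Finset.card_insert_of_notMem hAB.1, Finset.card_insert_of_notMem hAB'.1, hB])
      (Finset.disjoint_insert_right.2 ⟨ha, hAB.2⟩) (Finset.disjoint_insert_right.2 ⟨hbA, hAB'.2⟩)
      (by rw [Finset.card_insert_of_notMem hAB.1]; omega)
    have h3 := split a A B
    have h4 := split b A' B'
    omega


/-- If `U_1, …, U_K ⊆ {1, …, F}` all have the same cardinality, have constant degree `t`
with `t ≤ N ≤ K`, and the telescoping union sum is the same for every ordered `N`-tuple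
of distinct indices, then `C(K,t)` divides `F`. -/
theorem stmt_4 (K N F t : ℕ) (hK : 0 < K) (hN : 0 < N) (hF : 0 < F) (ht : 0 < t)
    (htN : t ≤ N) (hNK : N ≤ K) (U : Fin K → Finset (Fin F))
    (hcard : ∀ i j : Fin K, (U i).card = (U j).card)
    (hdeg : ∀ j : Fin F, (Finset.univ.filter (fun i => j ∈ U i)).card = t)
    (hS : ∀ d d' : Fin N → Fin K, Function.Injective d → Function.Injective d' →
      (∑ k : Fin N, ((Finset.Iic k).biUnion fun i => U (d i)).card) =
      (∑ k : Fin N, ((Finset.Iic k).biUnion fun i => U (d' i)).card)) :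
    Nat.choose K t ∣ F := by
  obtain ⟨n, rfl⟩ : ∃ n, K = n + 1 := ⟨K - 1, by omega⟩
  have union_card {A B : Finset (Fin (n + 1))} (hAB : A.card = B.card) (hA : A.card ≤ N) :
      (A.biUnion U).card = (B.biUnion U).card := by
    refine Finset.eq_of_sum_initial_segments_eq (fun A => (A.biUnion U).card)
      (fun σ τ => ?_) hAB hA
    have key (σ : Equiv.Perm (Fin (n + 1))) (k : Fin N) :
        ((Finset.univ.filter (fun i : Fin (n + 1) => i.val < k.val + 1)).map
          σ.toEmbedding).biUnion U =
        (Finset.Iic k).biUnion fun i => U ((σ ∘ Fin.castLE hNK) i) := by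
      ext x
      simp only [Finset.mem_biUnion, Finset.mem_map, Finset.mem_filter, Finset.mem_univ, true_and,
        Finset.mem_Iic, Function.comp_apply]
      constructor
      · rintro ⟨_, ⟨i, hi, rfl⟩, hx⟩
        exact ⟨⟨i, by omega⟩, by rw [Fin.le_def]; simp; omega, hx⟩
      · rintro ⟨i, hi, hx⟩
        exact ⟨_, ⟨Fin.castLE hNK i, by rw [Fin.le_def] at hi; simp; omega, rfl⟩, hx⟩
    simp only [← Fin.sum_univ_eq_sum_range
      (fun k => (((Finset.univ.filter (fun i : Fin (n + 1) => i.val < k + 1)).map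
        (Equiv.toEmbedding _)).biUnion U).card), key]
    exact hS _ _ (σ.injective.comp (Fin.castLE_injective hNK))
      (τ.injective.comp (Fin.castLE_injective hNK))
  have missed_card (B B' : Finset (Fin (n + 1))) (hB : B.card = B'.card) (hN : B.card ≤ N) :
      (Finset.univ.filter (fun j => ∀ i ∈ B, j ∉ U i)).card =
      (Finset.univ.filter (fun j => ∀ i ∈ B', j ∉ U i)).card := by
    have compl_eq (B : Finset (Fin (n + 1))) :
        Finset.univ.filter (fun j => ∀ i ∈ B, j ∉ U i) = (B.biUnion U)ᶜ := by
      ext j; simp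
    rw [compl_eq, compl_eq, Finset.card_compl, Finset.card_compl, union_card hB hN]
  have fiber_eq {A : Finset (Fin (n + 1))} (hA : A.card = t) :
      (Finset.univ.filter (fun j : Fin F => Finset.univ.filter (fun i => j ∈ U i) = A)) =
      Finset.univ.filter (fun j => (∀ i ∈ A, j ∈ U i) ∧
        ∀ i ∈ (∅ : Finset (Fin (n + 1))), j ∉ U i) := by
    ext j
    simp only [Finset.mem_filter, Finset.mem_univ, true_and, Finset.notMem_empty,
      false_imp_iff, implies_true, and_true]
    constructor
    · rintro rfl; simp
    · intro hj
      refine (Finset.eq_of_subset_of_card_le (fun i hi => by simpa using hj i hi) ?_).symm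
      rw [hdeg, hA]
  obtain ⟨A₀, -, hA₀⟩ := Finset.exists_subset_card_eq
    (show t ≤ (Finset.univ : Finset (Fin (n + 1))).card by simpa using htN.trans hNK)
  have total := Finset.card_eq_sum_card_fiberwise (s := (Finset.univ : Finset (Fin F)))
    (t := Finset.powersetCard t Finset.univ) (f := fun j => Finset.univ.filter (fun i => j ∈ U i))
    (fun j _ => by simp [Finset.mem_powersetCard, hdeg])
  have fiber_card_eq (A : Finset (Fin (n + 1))) (hA : A ∈ Finset.powersetCard t Finset.univ) :
      (Finset.univ.filter (fun j : Fin F => Finset.univ.filter (fun i => j ∈ U i) = A)).card =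
      (Finset.univ.filter (fun j : Fin F => Finset.univ.filter (fun i => j ∈ U i) = A₀)).card := by
    have hAt := (Finset.mem_powersetCard.1 hA).2
    rw [fiber_eq hAt, fiber_eq hA₀]
    convert Finset.card_filter_mem_notMem_eq U N
      (fun B B' hB hN => by convert missed_card B B' hB hN) (hAt.trans hA₀.symm)
      (rfl : (∅ : Finset (Fin (n + 1))).card = _)
      (Finset.disjoint_empty_right _) (Finset.disjoint_empty_right _) (by simp; omega)
  rw [Finset.sum_congr rfl fiber_card_eq] at total
  rw [Finset.sum_const, Finset.card_powersetCard, Finset.card_univ, Finset.card_univ,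
    Fintype.card_fin, Fintype.card_fin, smul_eq_mul] at total
  exact Dvd.intro _ total.symm
end

section
/- Let K, N, F, t be positive integers with N ≤ K. Let U_1, …, U_K be subsets of {1, …, F}, all of the same cardinality, such that every element j ∈ {1, …, F} belongs to exactly t of the sets U_1, …, U_K. Suppose that the sum S_{(d_1,…,d_N)} = Σ_{k=1}^{N} |U_{d_1} ∪ U_{d_2} ∪ ⋯ ∪ U_{d_k}| takes the same value for every ordered N-tuple (d_1, …, d_N) of distinct elements of {1, …, K}. Then for every k ∈ {1, …, N}, the binomial coefficient C(K,k) divides C(t,k)·F (with the convention C(t,k) = 0 when k > t). -/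
open Finset in
/-- Swapping two adjacent positions changes only the prefix that separates them. -/
theorem image_prefix_mul_swap {n : ℕ} (σ : Equiv.Perm (Fin (n + 1))) (j : Fin n) {m : ℕ}
    (hm : m ≠ j + 1) :
    (univ.filter fun x : Fin (n + 1) => (x : ℕ) < m).image
        (σ * Equiv.swap j.castSucc j.succ : Equiv.Perm (Fin (n + 1))) =
      (univ.filter fun x : Fin (n + 1) => (x : ℕ) < m).image σ := by
  have key : ∀ x : Fin (n + 1),
      ((Equiv.swap j.castSucc j.succ x : Fin (n + 1)) : ℕ) < m ↔ (x : ℕ) < m := by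
    intro x
    rw [Equiv.swap_apply_def]
    split_ifs with h₁ h₂
    · subst h₁; simp; omega
    · subst h₂; simp; omega
    · rfl
  ext y
  simp only [mem_image, mem_filter, mem_univ, true_and]
  constructor
  · rintro ⟨x, hx, rfl⟩
    exact ⟨Equiv.swap j.castSucc j.succ x, (key x).2 hx, rfl⟩
  · rintro ⟨x, hx, rfl⟩
    exact ⟨Equiv.swap j.castSucc j.succ x, (key x).2 hx, by simp⟩

/-- A function of permutations that is invariant under adjacent transpositions is constant. -/
theorem apply_eq_apply_one_of_mul_swap_invariant {n : ℕ} {α : Type*} (P : Equiv.Perm (Fin (n + 1)) → α)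
    (h : ∀ σ (j : Fin n), P (σ * Equiv.swap j.castSucc j.succ) = P σ)
    (σ : Equiv.Perm (Fin (n + 1))) : P σ = P 1 := by
  have hσ : σ ∈ Submonoid.closure
      (Set.range fun i : Fin n => Equiv.swap i.castSucc i.succ) := by
    rw [Equiv.Perm.mclosure_swap_castSucc_succ]; trivial
  induction hσ using Submonoid.closure_induction_right with
  | one => rfl
  | mul_right x _ y hy ih =>
    obtain ⟨j, rfl⟩ := hy
    exact (h x j).trans ih

open Finset in
/-- If the sum of a set function over the first `N` nonempty prefixes does not depend on the
ordering, then the function depends only on the cardinality for sets of size at most `N`. -/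
theorem eq_of_card_eq_of_sum_prefix_const {n N : ℕ} (f : Finset (Fin (n + 1)) → ℕ)
    (hf : ∀ σ τ : Equiv.Perm (Fin (n + 1)),
      ∑ k ∈ range N, f ((univ.filter fun x : Fin (n + 1) => (x : ℕ) < k + 1).image σ) =
      ∑ k ∈ range N, f ((univ.filter fun x : Fin (n + 1) => (x : ℕ) < k + 1).image τ))
    (A B : Finset (Fin (n + 1))) (hAB : A.card = B.card) (hA : A.card ≤ N) : f A = f B := by
  set P : ℕ → Equiv.Perm (Fin (n + 1)) → ℕ := fun m σ =>
    f ((univ.filter fun x : Fin (n + 1) => (x : ℕ) < m).image σ) with hP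
  have hne : ∀ (m : ℕ) σ (j : Fin n), m ≠ (j : ℕ) + 1 →
      P m (σ * Equiv.swap j.castSucc j.succ) = P m σ := fun m σ j h => by
    simp only [hP]
    rw [image_prefix_mul_swap σ j h]
  have hlt : ∀ m < N, ∀ σ, P m σ = P m 1 := by
    intro m hm σ
    refine apply_eq_apply_one_of_mul_swap_invariant (P m) (fun σ j => ?_) σ
    by_cases h : m = j + 1
    · have hj : (j : ℕ) ∈ range N := mem_range.2 (by omega)
      have hs := hf (σ * Equiv.swap j.castSucc j.succ) σ
      rw [← add_sum_erase _ _ hj, ← add_sum_erase _ _ hj] at hs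
      have he : ∑ k ∈ (range N).erase j, P (k + 1) (σ * Equiv.swap j.castSucc j.succ) =
          ∑ k ∈ (range N).erase j, P (k + 1) σ :=
        sum_congr rfl fun k hk => hne _ _ _ (by have := ne_of_mem_erase hk; omega)
      simp only [hP] at he ⊢
      rw [he] at hs
      rw [h]
      exact Nat.add_right_cancel hs
    · exact hne m σ j h
  have hle : ∀ m ≤ N, ∀ σ, P m σ = P m 1 := by
    intro m hm σ
    rcases hm.lt_or_eq with h | rfl
    · exact hlt m h σ
    · cases m with
      | zero => simp [hP]
      | succ m =>
        have hs : ∑ k ∈ range (m + 1), P (k + 1) σ = ∑ k ∈ range (m + 1), P (k + 1) 1 := hf σ 1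
        rw [sum_range_succ, sum_range_succ] at hs
        rw [sum_congr rfl fun k hk => hlt (k + 1) (by have := mem_range.1 hk; omega) σ] at hs
        exact Nat.add_left_cancel hs
  have hall : ∀ C : Finset (Fin (n + 1)), C.card ≤ N → f C = P C.card 1 := by
    intro C hC
    have hcard : (univ.filter fun x : Fin (n + 1) => (x : ℕ) < C.card).card = C.card := by
      rw [Fin.card_filter_val_lt]
      exact min_eq_right (by simpa using card_le_univ C)
    let e := equivOfCardEq hcard
    rw [← hle _ hC (Equiv.extendSubtype e)]
    simp only [hP]
    congr 1
    symm
    apply eq_of_subset_of_card_le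
    · intro y hy
      obtain ⟨x, hx, rfl⟩ := mem_image.1 hy
      exact e.extendSubtype_mem x hx
    · rw [card_image_of_injective _ (Equiv.injective _), hcard]
  rw [hall A hA, hall B (hAB ▸ hA), hAB]

open Finset in
/-- Double counting of the incidences between points and `k`-fold intersections. -/
theorem sum_card_inf_powersetCard {ι α : Type*} [Fintype ι] [DecidableEq ι] [Fintype α]
    [DecidableEq α] (U : ι → Finset α) {t : ℕ}
    (hdeg : ∀ j, (univ.filter fun i => j ∈ U i).card = t) (k : ℕ) :
    ∑ A ∈ powersetCard k (univ : Finset ι), (A.inf U).card = t.choose k * Fintype.card α := by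
  have h := sum_card_bipartiteAbove_eq_sum_card_bipartiteBelow
    (s := powersetCard k (univ : Finset ι)) (t := (univ : Finset α)) (fun A j => j ∈ A.inf U)
  have hl : ∀ A : Finset ι, bipartiteAbove (fun A j => j ∈ A.inf U) univ A = A.inf U := by
    intro A; ext; simp [bipartiteAbove]
  have hr : ∀ j : α, bipartiteBelow (fun A j => j ∈ A.inf U)
      (powersetCard k (univ : Finset ι)) j = powersetCard k (univ.filter fun i => j ∈ U i) := by
    intro j
    ext A
    simp only [bipartiteBelow, mem_filter, mem_powersetCard, mem_inf, mem_univ, true_and,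
      subset_iff, implies_true]
    exact and_comm
  simp only [hl, hr, card_powersetCard, hdeg, sum_const, card_univ, smul_eq_mul] at h
  rw [h, mul_comm]

open Finset in
/-- Inclusion–exclusion expressing the size of an intersection through sizes of unions. -/
theorem card_inf_eq_sum_card_biUnion {ι α : Type*} [DecidableEq ι] [Fintype α]
    [DecidableEq α] (U : ι → Finset α) (A : Finset ι) :
    ((A.inf U).card : ℤ) =
      ∑ B ∈ A.powerset, (-1) ^ B.card * ((Fintype.card α : ℤ) - (B.biUnion U).card) := by
  have h := inclusion_exclusion_card_inf_compl A fun i => (U i)ᶜ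
  simp only [compl_compl] at h
  rw [h]
  refine sum_congr rfl fun B _ => ?_
  have hB : (B.inf fun i => (U i)ᶜ) = (B.biUnion U)ᶜ := by
    ext; simp [mem_inf]
  rw [hB, card_compl, Nat.cast_sub (card_le_univ _)]

open Finset in
/-- If the union sizes of at most `N` sets depend only on the number of sets, so do the
intersection sizes. -/
theorem card_inf_eq_of_card_biUnion_eq {ι α : Type*} [DecidableEq ι] [Fintype α]
    [DecidableEq α] (U : ι → Finset α) {N : ℕ}
    (hU : ∀ A B : Finset ι, A.card = B.card → A.card ≤ N →
      (A.biUnion U).card = (B.biUnion U).card)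
    (A B : Finset ι) (hAB : A.card = B.card) (hA : A.card ≤ N) :
    (A.inf U).card = (B.inf U).card := by
  zify
  rw [card_inf_eq_sum_card_biUnion, card_inf_eq_sum_card_biUnion, sum_powerset, sum_powerset, hAB]
  refine sum_congr rfl fun m hm => ?_
  have hmB : m ≤ B.card := Nat.lt_succ_iff.1 (mem_range.1 hm)
  obtain ⟨C, hCB, hC⟩ := exists_subset_card_eq hmB
  have hconst : ∀ D : Finset ι, D.card = m →
      (-1 : ℤ) ^ D.card * ((Fintype.card α : ℤ) - (D.biUnion U).card) =
        (-1) ^ m * ((Fintype.card α : ℤ) - (C.biUnion U).card) := fun D hD => by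
    rw [hU D C (hD.trans hC.symm) (by omega), hD]
  rw [sum_congr rfl fun D hD => hconst D (mem_powersetCard.1 hD).2,
    sum_congr (s₁ := powersetCard m B) rfl fun D hD => hconst D (mem_powersetCard.1 hD).2,
    sum_const, sum_const, card_powersetCard, card_powersetCard, hAB]


/-- If `U_1, …, U_K ⊆ {1, …, F}` all have the same cardinality, have constant degree `t`,
`N ≤ K`, and the telescoping union sum is the same for every ordered `N`-tuple of distinct
indices, then `C(K,k)` divides `C(t,k)·F` for every `k ∈ {1,…,N}`. -/
theorem stmt_5 (K N F t : ℕ) (hK : 0 < K) (hN : 0 < N) (hF : 0 < F) (ht : 0 < t)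
    (hNK : N ≤ K) (U : Fin K → Finset (Fin F))
    (hcard : ∀ i j : Fin K, (U i).card = (U j).card)
    (hdeg : ∀ j : Fin F, (Finset.univ.filter (fun i => j ∈ U i)).card = t)
    (hS : ∀ d d' : Fin N → Fin K, Function.Injective d → Function.Injective d' →
      (∑ k : Fin N, ((Finset.Iic k).biUnion fun i => U (d i)).card) =
      (∑ k : Fin N, ((Finset.Iic k).biUnion fun i => U (d' i)).card)) :
    ∀ k : ℕ, 1 ≤ k → k ≤ N → Nat.choose K k ∣ Nat.choose t k * F := by
  intro k _ hkN
  obtain ⟨n, rfl⟩ : ∃ n, K = n + 1 := ⟨K - 1, by omega⟩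
  have horder : ∀ σ : Equiv.Perm (Fin (n + 1)),
      ∑ m ∈ Finset.range N, (((Finset.univ.filter fun x : Fin (n + 1) =>
        (x : ℕ) < m + 1).image σ).biUnion U).card =
      ∑ m : Fin N, ((Finset.Iic m).biUnion fun i => U (σ (Fin.castLE hNK i))).card := by
    intro σ
    rw [Finset.sum_range]
    refine Finset.sum_congr rfl fun m _ => congrArg Finset.card ?_
    ext y
    simp only [Finset.image_biUnion, Finset.mem_biUnion, Finset.mem_filter, Finset.mem_univ,
      true_and, Finset.mem_Iic]
    constructor
    · rintro ⟨x, hx, hy⟩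
      exact ⟨⟨x, by omega⟩, Fin.le_def.2 (Nat.lt_succ_iff.1 hx), hy⟩
    · rintro ⟨x, hx, hy⟩
      exact ⟨Fin.castLE hNK x, Nat.lt_succ_iff.2 hx, hy⟩
  have hunion := eq_of_card_eq_of_sum_prefix_const (N := N) (fun A => (A.biUnion U).card)
    fun σ τ => by
      rw [horder, horder]
      exact hS _ _ (σ.injective.comp (Fin.castLE_injective hNK))
        (τ.injective.comp (Fin.castLE_injective hNK))
  have hinter := card_inf_eq_of_card_biUnion_eq U hunion
  obtain ⟨C, -, hC⟩ := Finset.exists_subset_card_eq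
    (show k ≤ (Finset.univ : Finset (Fin (n + 1))).card by simpa using hkN.trans hNK)
  have hcount := sum_card_inf_powersetCard U hdeg k
  rw [Finset.sum_congr rfl fun A hA => hinter A C
    ((Finset.mem_powersetCard.1 hA).2.trans hC.symm)
    ((Finset.mem_powersetCard.1 hA).2.trans_le hkN)] at hcount
  simp only [Finset.sum_const, Finset.card_powersetCard, Finset.card_univ, Fintype.card_fin,
    smul_eq_mul] at hcount
  exact ⟨_, hcount.symm⟩
end

section
/- Let K, N, F, t be positive integers with N ≤ K and t ≤ K, and let U_1, …, U_K be subsets of {1, …, F} such that every element j ∈ {1, …, F} belongs to exactly t of the sets U_1, …, U_K. Then the sum, over all ordered N-tuples (d_1, …, d_N) of distinct elements of {1, …, K}, of the quantity Σ_{k=1}^{N} |U_{d_1} ∪ U_{d_2} ∪ ⋯ ∪ U_{d_k}| equals Σ_{k=1}^{N} (k!·(K−k)!/(K−N)!)·F·(C(K,k) − C(K−t,k)), where C(·,·) denotes the binomial coefficient (with C(m,r) = 0 when r > m). -/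
open Finset in
/-- The number of injective tuples whose `i`-th entry lies in the `i`-th member of an
increasing chain of finite sets. -/
theorem card_injective_of_monotone {α : Type*} [Fintype α] [DecidableEq α] (B : ℕ → Finset α)
    (hB : Monotone B) (n : ℕ) :
    #{d : Fin n → α | Function.Injective d ∧ ∀ i : Fin n, d i ∈ B i} = ∏ i ∈ range n, (#(B i) - i) := by
  induction n with
  | zero => simp [Function.injective_of_subsingleton]
  | succ n ih =>
    rw [prod_range_succ, ← ih, card_eq_sum_card_fiberwise (f := Fin.init)
      (t := {d : Fin n → α | Function.Injective d ∧ ∀ i : Fin n, d i ∈ B i})]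
    · refine sum_const_nat fun e he => ?_
      simp only [mem_filter, mem_univ, true_and] at he
      have hsub : univ.image e ⊆ B n := by
        intro x hx
        obtain ⟨i, -, rfl⟩ := mem_image.1 hx
        exact hB i.2.le (he.2 i)
      have hc : #(B n \ univ.image e) = #(B n) - n := by
        rw [card_sdiff_of_subset hsub, card_image_of_injective _ he.1, card_univ, Fintype.card_fin]
      rw [← hc]
      refine card_nbij' (fun d => d (Fin.last n)) (fun a => Fin.snoc e a) ?_ ?_ ?_ ?_
      · intro d hd
        simp only [coe_filter, mem_filter, mem_univ, true_and, Set.mem_ofPred_eq] at hd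
        obtain ⟨⟨hinj, hmem⟩, rfl⟩ := hd
        simp only [coe_sdiff, Set.mem_sdiff, mem_coe, mem_image, mem_univ, true_and, not_exists]
        refine ⟨by simpa using hmem (Fin.last n), fun i hi => ?_⟩
        exact (Fin.castSucc_lt_last i).ne (hinj hi)
      · intro a ha
        simp only [coe_sdiff, Set.mem_sdiff, mem_coe, mem_image, mem_univ, true_and] at ha
        simp only [coe_filter, mem_filter, mem_univ, true_and, Set.mem_ofPred_eq, Fin.init_snoc,
          and_true]
        refine ⟨Fin.snoc_injective_iff.2 ⟨he.1, by simpa using ha.2⟩, fun i => ?_⟩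
        induction i using Fin.lastCases with
        | last => simpa using ha.1
        | cast i => simpa using he.2 i
      · intro d hd
        simp only [coe_filter, mem_filter, mem_univ, true_and, Set.mem_ofPred_eq] at hd
        simp [← hd.2]
      · intro a _
        simp
    · intro d hd
      simp only [coe_filter, mem_univ, true_and, Set.mem_ofPred_eq] at hd ⊢
      exact ⟨hd.1.comp (Fin.castSucc_injective n), fun i => hd.2 i.castSucc⟩

open Finset in
/-- The number of injective `N`-tuples whose first `m` entries lie in `A`. -/
theorem card_injective_of_forall_lt_mem {α : Type*} [Fintype α] [DecidableEq α] (A : Finset α)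
    {m N : ℕ} (hm : m ≤ N) :
    #{d : Fin N → α | Function.Injective d ∧ ∀ i : Fin N, (i : ℕ) < m → d i ∈ A} =
      (#A).descFactorial m * (Fintype.card α - m).descFactorial (N - m) := by
  have hB : Monotone fun i : ℕ => if i < m then A else univ := by
    intro i j hij
    dsimp only
    split_ifs
    · exact le_rfl
    · exact subset_univ _
    · omega
    · exact le_rfl
  have h := card_injective_of_monotone _ hB N
  obtain ⟨r, rfl⟩ := Nat.exists_eq_add_of_le hm
  rw [prod_range_add] at h
  rw [Nat.descFactorial_eq_prod_range, Nat.descFactorial_eq_prod_range, Nat.add_sub_cancel_left]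
  refine Eq.trans (congrArg card (filter_congr fun d _ => ?_)) (h.trans (congrArg₂ _ ?_ ?_))
  · refine and_congr_right fun _ => forall_congr' fun i => ?_
    split_ifs with hi <;> simp [hi]
  · refine prod_congr rfl fun i hi => ?_
    rw [if_pos (mem_range.1 hi)]
  · refine prod_congr rfl fun i _ => ?_
    rw [if_neg (by omega), card_univ, Nat.sub_sub]

open Finset in
/-- The number of injective `N`-tuples with some entry among the first `m` in `S`. -/
theorem card_injective_of_exists_lt_mem {α : Type*} [Fintype α] [DecidableEq α] (S : Finset α)
    {m N : ℕ} (hm : m ≤ N) (hN : N ≤ Fintype.card α) :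
    #{d : Fin N → α | Function.Injective d ∧ ∃ i : Fin N, (i : ℕ) < m ∧ d i ∈ S} =
      m.factorial * (Fintype.card α - m).factorial / (Fintype.card α - N).factorial *
        ((Fintype.card α).choose m - (Fintype.card α - #S).choose m) := by
  have htot := card_injective_of_forall_lt_mem (univ : Finset α) hm
  have hav := card_injective_of_forall_lt_mem Sᶜ hm
  have hsplit := card_filter_add_card_filter_not
    (s := ({d : Fin N → α | Function.Injective d} : Finset _))
    (fun d => ∃ i : Fin N, (i : ℕ) < m ∧ d i ∈ S)
  simp only [filter_filter, not_exists, not_and] at hsplit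
  simp only [mem_univ, implies_true, and_true, mem_compl, card_univ, card_compl] at htot hav
  have hdiv : m.factorial * (Fintype.card α - m).factorial / (Fintype.card α - N).factorial =
      m.factorial * (Fintype.card α - m).descFactorial (N - m) := by
    have h := Nat.factorial_mul_descFactorial
      (show N - m ≤ Fintype.card α - m by omega)
    rw [show Fintype.card α - m - (N - m) = Fintype.card α - N by omega] at h
    rw [← h, Nat.mul_left_comm, Nat.mul_div_cancel_left _ (Nat.factorial_pos _)]
  rw [hav, htot] at hsplit
  rw [hdiv, Nat.mul_sub, eq_tsub_of_add_eq hsplit, Nat.descFactorial_eq_factorial_mul_choose,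
    Nat.descFactorial_eq_factorial_mul_choose (_ - #S)]
  congr 1 <;> ring


/-- If `U_1, …, U_K ⊆ {1, …, F}` have constant degree `t ≤ K` and `N ≤ K`, then the sum
over all ordered `N`-tuples `(d_1, …, d_N)` of distinct elements of `{1, …, K}` of
`Σ_{k=1}^N |U_{d_1} ∪ ⋯ ∪ U_{d_k}|` equals
`Σ_{k=1}^N (k!·(K−k)!/(K−N)!)·F·(C(K,k) − C(K−t,k))`. -/
theorem stmt_6 (K N F t : ℕ) (hK : 0 < K) (hN : 0 < N) (hF : 0 < F) (ht : 0 < t)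
    (hNK : N ≤ K) (htK : t ≤ K) (U : Fin K → Finset (Fin F))
    (hdeg : ∀ j : Fin F, (Finset.univ.filter (fun i => j ∈ U i)).card = t) :
    ∑ d ∈ Finset.univ.filter (fun d : Fin N → Fin K => Function.Injective d),
      ∑ k : Fin N, ((Finset.Iic k).biUnion fun i => U (d i)).card
      = ∑ k ∈ Finset.Icc 1 N,
          (Nat.factorial k * Nat.factorial (K - k) / Nat.factorial (K - N)) *
            (F * (Nat.choose K k - Nat.choose (K - t) k)) := by
  have hcard (k : Fin N) :
      ∑ d ∈ Finset.univ.filter (fun d : Fin N → Fin K => Function.Injective d),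
        ((Finset.Iic k).biUnion fun i => U (d i)).card =
      (Nat.factorial (k + 1) * Nat.factorial (K - (k + 1)) / Nat.factorial (K - N)) *
        (F * (Nat.choose K (k + 1) - Nat.choose (K - t) (k + 1))) := by
    have hcount (j : Fin F) := card_injective_of_exists_lt_mem
      (Finset.univ.filter fun i => j ∈ U i) (Nat.succ_le_of_lt k.2) (by simpa using hNK)
    simp only [hdeg, Fintype.card_fin, Finset.mem_filter, Finset.mem_univ, true_and,
      Nat.succ_eq_add_one] at hcount
    have hswap := Finset.sum_card_bipartiteAbove_eq_sum_card_bipartiteBelow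
      (s := Finset.univ.filter (fun d : Fin N → Fin K => Function.Injective d))
      (t := (Finset.univ : Finset (Fin F)))
      (fun d j => ∃ i : Fin N, (i : ℕ) < k + 1 ∧ j ∈ U (d i))
    simp only [Finset.bipartiteAbove, Finset.bipartiteBelow, Finset.filter_filter, hcount,
      Finset.sum_const, Finset.card_univ, Fintype.card_fin, smul_eq_mul] at hswap
    rw [Nat.mul_left_comm, ← hswap]
    refine Finset.sum_congr rfl fun d _ => congrArg Finset.card ?_
    ext j
    simp
  rw [Finset.sum_comm, Finset.sum_congr rfl fun k _ => hcard k,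
    Fin.sum_univ_eq_sum_range (fun k =>
      (Nat.factorial (k + 1) * Nat.factorial (K - (k + 1)) / Nat.factorial (K - N)) *
        (F * (Nat.choose K (k + 1) - Nat.choose (K - t) (k + 1)))) N,
    Finset.range_eq_Ico, Finset.sum_Ico_add' (fun k =>
      (Nat.factorial k * Nat.factorial (K - k) / Nat.factorial (K - N)) *
        (F * (Nat.choose K k - Nat.choose (K - t) k))) 0 N 1]
  rfl
end

section
/- Let f, g : ℕ → ℕ be sequences of positive integers such that f(n)/g(n) → 0 and f(n)²/g(n) → 0 as n → ∞. Then the sequence C(g(n), f(n)) · f(n)! / g(n)^{f(n)} converges to 1 as n → ∞. -/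
/-- Falling factorials are close to powers: `1 - k² / n ≤ n (n - 1) ⋯ (n - k + 1) / n ^ k`. -/
theorem one_sub_sq_div_le_descFactorial_div_pow {n : ℕ} (hn : 0 < n) (k : ℕ) :
    1 - (k : ℝ) ^ 2 / n ≤ (n.descFactorial k : ℝ) / (n : ℝ) ^ k := by
  have hn' : (0 : ℝ) < n := by exact_mod_cast hn
  rcases le_or_gt k n with hk | hk
  · have hk' : (k : ℝ) ≤ n := by exact_mod_cast hk
    have hdiv : (k : ℝ) / n ≤ 1 := (div_le_one hn').2 hk'
    have bernoulli := one_add_mul_le_pow (a := -((k : ℝ) / n)) (by linarith) k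
    have hpow : ((n : ℝ) - k) ^ k ≤ n.descFactorial k := by
      calc ((n : ℝ) - k) ^ k ≤ (n + 1 - k) ^ k :=
            pow_le_pow_left₀ (by linarith) (by linarith) k
        _ = ((n + 1 - k : ℕ) : ℝ) ^ k := by
            rw [Nat.cast_sub (by omega)]
            push_cast
            rfl
        _ ≤ n.descFactorial k := by exact_mod_cast n.pow_sub_le_descFactorial k
    calc 1 - (k : ℝ) ^ 2 / n = 1 + k * -((k : ℝ) / n) := by ring
      _ ≤ (1 + -((k : ℝ) / n)) ^ k := bernoulli
      _ = ((n : ℝ) - k) ^ k / (n : ℝ) ^ k := by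
          rw [← div_pow]
          congr 1
          field_simp
          ring
      _ ≤ (n.descFactorial k : ℝ) / (n : ℝ) ^ k := by gcongr
  · have hk' : (n : ℝ) ≤ k := by exact_mod_cast hk.le
    have hone : (1 : ℝ) ≤ n := by exact_mod_cast hn
    have hsq : 1 ≤ (k : ℝ) ^ 2 / n := (one_le_div hn').2 (by nlinarith)
    have hnonneg : 0 ≤ (n.descFactorial k : ℝ) / (n : ℝ) ^ k := by positivity
    linarith

/-- If `f(n)/g(n) → 0` and `f(n)²/g(n) → 0`, then
`C(g(n), f(n)) · f(n)! / g(n)^{f(n)} → 1`. -/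
theorem stmt_7 (f g : ℕ → ℕ) (hf : ∀ n, 0 < f n) (hg : ∀ n, 0 < g n)
    (h1 : Filter.Tendsto (fun n => (f n : ℝ) / (g n : ℝ)) Filter.atTop (nhds 0))
    (h2 : Filter.Tendsto (fun n => (f n : ℝ) ^ 2 / (g n : ℝ)) Filter.atTop (nhds 0)) :
    Filter.Tendsto
      (fun n => ((Nat.choose (g n) (f n) : ℝ) * (Nat.factorial (f n) : ℝ)) / (g n : ℝ) ^ (f n))
      Filter.atTop (nhds 1) := by
  have hdesc (n : ℕ) : (Nat.choose (g n) (f n) : ℝ) * (Nat.factorial (f n) : ℝ) =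
      ((g n).descFactorial (f n) : ℝ) := by
    rw [Nat.descFactorial_eq_factorial_mul_choose, Nat.cast_mul, mul_comm]
  simp_rw [hdesc]
  refine tendsto_of_tendsto_of_tendsto_of_le_of_le (g := fun n => 1 - (f n : ℝ) ^ 2 / (g n : ℝ))
    (by simpa using h2.const_sub 1) tendsto_const_nhds
    (fun n => one_sub_sq_div_le_descFactorial_div_pow (hg n) (f n)) fun n => ?_
  have hle : ((g n).descFactorial (f n) : ℝ) ≤ (g n : ℝ) ^ f n := by
    exact_mod_cast (g n).descFactorial_le_pow (f n)
  exact div_le_one_of_le₀ hle (by positivity)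
end

section
/- Let n and a be positive integers and let b be a non-negative integer with a + b ≤ n. Then C(a+b, a) + C(n−b, a) ≤ C(n, a) + 1, where C(·,·) denotes the binomial coefficient. -/
/-- The case `n = a + b + c`, written with `k + 1` in place of the positive integer `a`. -/
theorem choose_add_choose_le_choose_add_one (k b c : ℕ) :
    (k + 1 + b).choose (k + 1) + (k + 1 + c).choose (k + 1) ≤
      (k + 1 + b + c).choose (k + 1) + 1 := by
  induction c with
  | zero => simp
  | succ c ih =>
    have hmono : (k + 1 + c).choose k ≤ (k + 1 + b + c).choose k :=
      Nat.choose_le_choose k (by omega)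
    rw [← add_assoc, ← add_assoc, Nat.choose_succ_succ' (k + 1 + c),
      Nat.choose_succ_succ' (k + 1 + b + c)]
    omega

/-- For positive `n, a` and `b ≥ 0` with `a + b ≤ n`,
`C(a+b,a) + C(n−b,a) ≤ C(n,a) + 1`. -/
theorem stmt_10 (n a b : ℕ) (hn : 0 < n) (ha : 0 < a) (hab : a + b ≤ n) :
    Nat.choose (a + b) a + Nat.choose (n - b) a ≤ Nat.choose n a + 1 := by
  obtain ⟨c, rfl⟩ := Nat.exists_eq_add_of_le hab
  obtain ⟨k, rfl⟩ := Nat.exists_eq_succ_of_ne_zero ha.ne'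
  have hsub : k + 1 + b + c - b = k + 1 + c := by omega
  simpa only [Nat.succ_eq_add_one, hsub] using choose_add_choose_le_choose_add_one k b c
end

section
/- Let n and a be positive integers and let b be a non-negative integer with a + b ≤ n. Then C(n, a+b) · (1 + C(n,a) − C(n−b, a)) ≥ C(n, b) · C(n−b, a); equivalently, the real number R = C(n,a+b)/C(n,b) satisfies R ≥ C(n−b,a)/(1 + C(n,a) − C(n−b,a)). Here C(·,·) denotes the binomial coefficient. -/
theorem Nat.choose_add_choose_le_one_add_choose (a b k : ℕ) :
    (a + b).choose a + (a + k).choose a ≤ 1 + (a + b + k).choose a := by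
  cases a with
  | zero => simp
  | succ a =>
    induction k with
    | zero => simp [add_comm]
    | succ k ih =>
      have h₁ := Nat.choose_succ_succ' (a + 1 + k) a
      have h₂ := Nat.choose_succ_succ' (a + 1 + b + k) a
      have h₃ : (a + 1 + k).choose a ≤ (a + 1 + b + k).choose a :=
        Nat.choose_le_choose a (by omega)
      simp only [← add_assoc]
      omega

/-- For positive `n, a` and `b ≥ 0` with `a + b ≤ n`,
`C(n,a+b)·(1 + C(n,a) − C(n−b,a)) ≥ C(n,b)·C(n−b,a)`; equivalently,
`C(n,a+b)/C(n,b) ≥ C(n−b,a)/(1 + C(n,a) − C(n−b,a))` in the reals. -/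
theorem stmt_12 (n a b : ℕ) (hn : 0 < n) (ha : 0 < a) (hab : a + b ≤ n) :
    Nat.choose n b * Nat.choose (n - b) a ≤
      Nat.choose n (a + b) * (1 + Nat.choose n a - Nat.choose (n - b) a) ∧
    (Nat.choose (n - b) a : ℝ) /
        (1 + (Nat.choose n a : ℝ) - (Nat.choose (n - b) a : ℝ)) ≤
      (Nat.choose n (a + b) : ℝ) / (Nat.choose n b : ℝ) := by
  have key : (a + b).choose b + (n - b).choose a ≤ 1 + n.choose a := by
    obtain ⟨k, rfl⟩ := Nat.exists_eq_add_of_le hab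
    have h := Nat.choose_add_choose_le_one_add_choose a b k
    rwa [Nat.choose_symm_add, show a + k = a + b + k - b by omega] at h
  have hmul : n.choose b * (n - b).choose a ≤
      n.choose (a + b) * (1 + n.choose a - (n - b).choose a) := by
    have h := Nat.choose_mul (n := n) (Nat.le_add_left b a)
    rw [Nat.add_sub_cancel] at h
    rw [← h]
    exact Nat.mul_le_mul_left _ (Nat.le_sub_of_add_le key)
  refine ⟨hmul, ?_⟩
  have hle : (n - b).choose a ≤ n.choose a := Nat.choose_le_choose a (Nat.sub_le n b)
  have hleR : ((n - b).choose a : ℝ) ≤ n.choose a := by exact_mod_cast hle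
  have hpos : (0 : ℝ) < n.choose b := by
    exact_mod_cast Nat.choose_pos (by omega : b ≤ n)
  rw [div_le_div_iff₀ (by linarith) hpos, mul_comm]
  have hcast : ((1 + n.choose a - (n - b).choose a : ℕ) : ℝ) =
      1 + (n.choose a : ℝ) - (n - b).choose a := by
    rw [Nat.cast_sub (by omega)]
    push_cast
    rfl
  rw [← hcast]
  exact_mod_cast hmul
end

section
/- Fix an integer c ≥ 2. For each integer n large enough that ⌈(log n)^c⌉ + c ≤ n, set a(n) = ⌈(log n)^c⌉ (natural logarithm) and b(n) = n − a(n) − c, and define the real numbers R(n) = C(n, a(n)+b(n)) / C(n, b(n)) and R₀(n) = C(n−b(n), a(n)) / (1 + C(n, a(n)) − C(n−b(n), a(n))). Then R(n) ≥ R₀(n) for all such n, and R(n)/R₀(n) → 1 as n → ∞. -/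
open Filter Topology

/-- Powers of the logarithm, rounded up, are negligible compared with `n`. -/
lemma tendsto_ceil_log_pow_div (c : ℕ) :
    Tendsto (fun n : ℕ => ((⌈(Real.log n) ^ c⌉₊ : ℕ) : ℝ) / n) atTop (𝓝 0) := by
  have h1 : Tendsto (fun n : ℕ => (Real.log n) ^ c / (n : ℝ)) atTop (𝓝 0) :=
    (Real.isLittleO_pow_log_id_atTop (n := c)).tendsto_div_nhds_zero.comp
      tendsto_natCast_atTop_atTop
  have h2 : Tendsto (fun n : ℕ => (1 : ℝ) / n) atTop (𝓝 0) := tendsto_one_div_atTop_nhds_zero_nat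
  refine squeeze_zero (fun n => by positivity) (fun n => ?_) (by simpa only [add_zero] using h1.add h2)
  rw [← add_div]
  gcongr
  exact (Nat.ceil_lt_add_one (pow_nonneg (Real.log_natCast_nonneg n) c)).le

/-- The increments `m ↦ C(m + c, k) - C(m, k)` are monotone in `m`. -/
lemma choose_add_add_choose_le (k c m d : ℕ) :
    (m + c).choose k + (m + d).choose k ≤ (m + d + c).choose k + m.choose k := by
  induction c with
  | zero => simp [add_comm]
  | succ c ih =>
    cases k with
    | zero => simp
    | succ k =>
      rw [← add_assoc, ← add_assoc, Nat.choose_succ_succ (m + c), Nat.choose_succ_succ (m + d + c)]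
      have := Nat.choose_le_choose k (show m + c ≤ m + d + c by lia)
      lia

/-- The ratio of `C(k + c, k)` to `C(k + b, k)` is at most that of `k + c` to `k + b`. -/
lemma choose_mul_add_le_mul_choose {k c b : ℕ} (hk : 1 ≤ k) (hcb : c ≤ b) :
    (k + c).choose k * (k + b) ≤ (k + c) * (k + b).choose k := by
  obtain ⟨j, rfl⟩ := Nat.exists_eq_add_of_le' hk
  have e1 := Nat.add_one_mul_choose_eq (j + c) j
  have e2 := Nat.add_one_mul_choose_eq (j + b) j
  have hle := Nat.choose_le_choose j (show j + c ≤ j + b by lia)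
  rw [show j + 1 + c = j + c + 1 by ring, show j + 1 + b = j + b + 1 by ring]
  refine Nat.le_of_mul_le_mul_right ?_ (Nat.succ_pos j)
  calc (j + c + 1).choose (j + 1) * (j + b + 1) * (j + 1)
      = (j + c + 1) * (j + b + 1) * (j + c).choose j := by
        linear_combination (j + b + 1) * e1.symm
    _ ≤ (j + c + 1) * (j + b + 1) * (j + b).choose j := by gcongr
    _ = (j + c + 1) * (j + b + 1).choose (j + 1) * (j + 1) := by
        linear_combination (j + c + 1) * e2

/-- The identity `C(n, c) / C(n, k + c) = C(k + c, k) / C(n - c, k)` with `n = k + b + c`. -/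
lemma choose_div_choose_eq (k b c : ℕ) :
    ((k + b + c).choose (k + b) : ℝ) / ((k + b + c).choose b : ℝ) =
      ((k + c).choose k : ℝ) / ((k + b).choose k : ℝ) := by
  have h1 : (0 : ℝ) < (k + b + c).choose b := by
    exact_mod_cast Nat.choose_pos (by lia)
  have h2 : (0 : ℝ) < (k + b).choose k := by exact_mod_cast Nat.choose_pos (by lia)
  rw [div_eq_div_iff h1.ne' h2.ne']
  have h := Nat.choose_mul (n := k + b + c) (k := k + b) (s := b) (by lia)
  rw [show k + b + c - b = k + c by lia, show k + b - b = k by lia,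
    Nat.choose_symm_of_eq_add (show k + b = b + k by ring)] at h
  rw [mul_comm ((k + c).choose k : ℝ)]
  exact_mod_cast h

/-- If `a n = o(n)`, then `C(n, a n) / C(n - c, a n)` tends to `1` for each fixed `c`. -/
lemma tendsto_choose_div_choose_sub {a : ℕ → ℕ}
    (ha : Tendsto (fun n => (a n : ℝ) / n) atTop (𝓝 0)) (c : ℕ) :
    Tendsto (fun n => (n.choose (a n) : ℝ) / ((n - c).choose (a n) : ℝ)) atTop (𝓝 1) := by
  have hsmall : ∀ c : ℕ, ∀ᶠ n in atTop, a n + c ≤ n := fun c => by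
    filter_upwards [ha.eventually_lt_const (show (0 : ℝ) < 1 / 2 by norm_num),
      eventually_ge_atTop (2 * c + 1)] with n h1 h2
    have hn : (0 : ℝ) < n := by exact_mod_cast (show 0 < n by lia)
    rw [div_lt_iff₀ hn] at h1
    have h2' : (2 * c + 1 : ℝ) ≤ n := by exact_mod_cast h2
    have : (a n + c : ℝ) ≤ n := by linarith
    exact_mod_cast this
  induction c with
  | zero =>
    refine tendsto_const_nhds.congr' ?_
    filter_upwards [hsmall 0] with n hn
    have : (0 : ℝ) < n.choose (a n) := by exact_mod_cast Nat.choose_pos (by lia)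
    simp [this.ne']
  | succ c ih =>
    have hc : Tendsto (fun n : ℕ => (c : ℝ) / n) atTop (𝓝 0) :=
      tendsto_const_div_atTop_nhds_zero_nat _
    have hstep : Tendsto (fun n : ℕ => (1 - (c : ℝ) / n) / (1 - (c : ℝ) / n - a n / n))
        atTop (𝓝 1) := by
      simpa [Pi.div_def] using (hc.const_sub 1).div ((hc.const_sub 1).sub ha) (by norm_num)
    have hprod := ih.mul hstep
    rw [mul_one] at hprod
    refine hprod.congr' ?_
    filter_upwards [hsmall (c + 1)] with n hn
    have hP : (0 : ℝ) < (n - c).choose (a n) := by exact_mod_cast Nat.choose_pos (by lia)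
    have hQ : (0 : ℝ) < (n - (c + 1)).choose (a n) := by
      exact_mod_cast Nat.choose_pos (by lia)
    have hn0 : (0 : ℝ) < n := by exact_mod_cast (show 0 < n by lia)
    have hn' : (a n + (c + 1) : ℝ) ≤ n := by exact_mod_cast hn
    have hd : (0 : ℝ) < n - c - a n := by linarith
    have h := Nat.choose_mul_succ_eq (n - (c + 1)) (a n)
    rw [show n - (c + 1) + 1 = n - c by lia] at h
    have h' : ((n - (c + 1)).choose (a n) : ℝ) * (n - c) =
        (n - c).choose (a n) * (n - c - a n) := by
      rw [← Nat.cast_sub (show c ≤ n by lia), ← Nat.cast_sub (show a n ≤ n - c by lia)]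
      exact_mod_cast h
    rw [one_sub_div hn0.ne', ← sub_div, div_div_div_cancel_right₀ hn0.ne', div_mul_div_comm,
      div_eq_div_iff (mul_pos hP hd).ne' hQ.ne']
    linear_combination (n.choose (a n) : ℝ) * h'

/-- With `a(n) = ⌈(log n)^c⌉`, `b(n) = n − a(n) − c`, `R(n) = C(n,a(n)+b(n))/C(n,b(n))`
and `R₀(n) = C(n−b(n),a(n))/(1 + C(n,a(n)) − C(n−b(n),a(n)))`: one has `R(n) ≥ R₀(n)`
whenever `a(n) + c ≤ n`, and `R(n)/R₀(n) → 1` as `n → ∞`. -/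
theorem stmt_13 (c : ℕ) (hc : 2 ≤ c) (a b : ℕ → ℕ)
    (ha : ∀ n, a n = ⌈(Real.log n) ^ c⌉₊) (hb : ∀ n, b n = n - a n - c)
    (R R₀ : ℕ → ℝ)
    (hR : ∀ n, R n = (Nat.choose n (a n + b n) : ℝ) / (Nat.choose n (b n) : ℝ))
    (hR₀ : ∀ n, R₀ n = (Nat.choose (n - b n) (a n) : ℝ) /
      (1 + (Nat.choose n (a n) : ℝ) - (Nat.choose (n - b n) (a n) : ℝ))) :
    (∀ n : ℕ, a n + c ≤ n → R₀ n ≤ R n) ∧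
    Filter.Tendsto (fun n => R n / R₀ n) Filter.atTop (nhds 1) := by
  have hR' : ∀ n, a n + c ≤ n →
      R n = ((a n + c).choose (a n) : ℝ) / ((n - c).choose (a n) : ℝ) := fun n hn => by
    have e := choose_div_choose_eq (a n) (b n) c
    rw [show a n + b n + c = n by grind] at e
    rw [hR, e, show a n + b n = n - c by grind]
  have hR₀' : ∀ n, a n + c ≤ n → R₀ n = ((a n + c).choose (a n) : ℝ) /
      (1 + (n.choose (a n) : ℝ) - ((a n + c).choose (a n) : ℝ)) := fun n hn => by
    rw [hR₀, show n - b n = a n + c by grind]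
  have hpos : ∀ n, a n + c ≤ n → (0 : ℝ) < (n - c).choose (a n) := fun n hn => by
    exact_mod_cast Nat.choose_pos (by lia)
  have hden : ∀ n, a n + c ≤ n → ((n - c).choose (a n) : ℝ) ≤
      1 + (n.choose (a n) : ℝ) - ((a n + c).choose (a n) : ℝ) := fun n hn => by
    have h := choose_add_add_choose_le (a n) c (a n) (b n)
    rw [show a n + b n + c = n by grind, show a n + b n = n - c by grind, Nat.choose_self] at h
    have h' : ((a n + c).choose (a n) : ℝ) + (n - c).choose (a n) ≤ n.choose (a n) + 1 := by
      exact_mod_cast h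
    linarith
  refine ⟨fun n hn => ?_, ?_⟩
  · rw [hR' n hn, hR₀' n hn]
    exact div_le_div_of_nonneg_left (by positivity) (hpos n hn) (hden n hn)
  have hlim : Tendsto (fun n => (a n : ℝ) / n) atTop (𝓝 0) := by
    simpa only [ha] using tendsto_ceil_log_pow_div c
  have hcn : Tendsto (fun n : ℕ => (c : ℝ) / n) atTop (𝓝 0) :=
    tendsto_const_div_atTop_nhds_zero_nat _
  have hev : ∀ᶠ n in atTop, a n + 2 * c ≤ n ∧ 1 ≤ a n := by
    filter_upwards [hlim.eventually_lt_const (show (0 : ℝ) < 1 / 2 by norm_num),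
      eventually_ge_atTop (4 * c + 2)] with n h1 h2
    have hn : (0 : ℝ) < n := by exact_mod_cast (show 0 < n by lia)
    rw [div_lt_iff₀ hn] at h1
    have h2' : (4 * c + 2 : ℝ) ≤ n := by exact_mod_cast h2
    have h3 : (a n + 2 * c : ℝ) ≤ n := by linarith
    refine ⟨by exact_mod_cast h3, ?_⟩
    rw [ha, Nat.one_le_ceil_iff]
    exact pow_pos (Real.log_pos (by linarith)) c
  have hR_lim : Tendsto R atTop (𝓝 0) := by
    have hbound : Tendsto (fun n : ℕ => ((a n : ℝ) / n + c / n) / (1 - c / n)) atTop (𝓝 0) := by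
      simpa [Pi.div_def] using (hlim.add hcn).div (hcn.const_sub 1) (by norm_num)
    refine squeeze_zero' (Eventually.of_forall fun n => by rw [hR]; positivity) ?_ hbound
    filter_upwards [hev] with n ⟨hn, han⟩
    have hle := choose_mul_add_le_mul_choose han (show c ≤ b n by grind)
    rw [show a n + b n = n - c by grind] at hle
    have hn0 : (0 : ℝ) < n := by exact_mod_cast (show 0 < n by lia)
    have hnc : (0 : ℝ) < ((n - c : ℕ) : ℝ) := by exact_mod_cast (show 0 < n - c by lia)
    have e : ((a n : ℝ) / n + c / n) / (1 - c / n) = ((a n + c : ℕ) : ℝ) / ((n - c : ℕ) : ℝ) := by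
      rw [← add_div, one_sub_div hn0.ne', div_div_div_cancel_right₀ hn0.ne',
        Nat.cast_sub (by lia), Nat.cast_add]
    rw [e, hR' n (by lia), div_le_div_iff₀ (hpos n (by lia)) hnc]
    exact_mod_cast hle
  have hinv_lim : Tendsto (fun n => 1 / ((n - c).choose (a n) : ℝ)) atTop (𝓝 0) := by
    refine squeeze_zero' (Eventually.of_forall fun n => by positivity) ?_ hR_lim
    filter_upwards [hev] with n ⟨hn, _⟩
    rw [hR' n (by lia)]
    gcongr
    exact_mod_cast Nat.choose_pos (by lia)
  have hsum := (hinv_lim.add (tendsto_choose_div_choose_sub hlim c)).sub hR_lim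
  rw [zero_add, sub_zero] at hsum
  refine hsum.congr' ?_
  filter_upwards [hev] with n ⟨hn, _⟩
  have hn' : a n + c ≤ n := by lia
  have hA : (0 : ℝ) < (a n + c).choose (a n) := by exact_mod_cast Nat.choose_pos (by lia)
  have hB := hpos n hn'
  have hD := hB.trans_le (hden n hn')
  rw [hR' n hn', hR₀' n hn', div_div_div_eq, ← add_div, ← sub_div,
    mul_comm (((n - c).choose (a n) : ℕ) : ℝ), mul_div_mul_left _ _ hA.ne']
end

section
/- Fix an integer c ≥ 2. For each integer n large enough that ⌈(log n)^c⌉ + c ≤ n, set a(n) = ⌈(log n)^c⌉ (natural logarithm) and b(n) = n − a(n) − c, and define F(n) = C(n, b(n)) and K(n) = C(n, a(n)). Then: (i) F(n) ≥ K(n) for all sufficiently large n; and (ii) limsup_{n→∞} F(n) / K(n)^{(a(n)+c)/a(n)} ≤ e^{−c} < 1, where the exponent (a(n)+c)/a(n) = (n−b(n))/a(n) is a real number. -/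
open Filter Topology in
/-- A consequence of Stirling's formula: the `n`-th root of `n!` is asymptotic to `n / e`. -/
theorem tendsto_factorial_rpow_inv_div :
    Tendsto (fun n : ℕ => (n.factorial : ℝ) ^ ((1 : ℝ) / n) / n) atTop (𝓝 (Real.exp (-1))) := by
  have h0 : Tendsto (fun n : ℕ => (1 : ℝ) / n) atTop (𝓝 0) := tendsto_one_div_atTop_nhds_zero_nat
  have h1 : Tendsto (fun n : ℕ => Stirling.stirlingSeq n ^ ((1 : ℝ) / n)) atTop (𝓝 1) := by
    have hπ : √Real.pi ≠ 0 := by positivity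
    simpa using Stirling.tendsto_stirlingSeq_sqrt_pi.rpow h0 (Or.inl hπ)
  have h2 : Tendsto (fun n : ℕ => (2 : ℝ) ^ ((1 : ℝ) / n)) atTop (𝓝 1) := by
    simpa using (tendsto_const_nhds (x := (2 : ℝ))).rpow h0 (Or.inl two_ne_zero)
  have h3 : Tendsto (fun n : ℕ => (n : ℝ) ^ ((1 : ℝ) / n)) atTop (𝓝 1) :=
    tendsto_rpow_div.comp tendsto_natCast_atTop_atTop
  have h4 : Tendsto (fun n : ℕ => Stirling.stirlingSeq n ^ ((1 : ℝ) / n) *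
      √((2 : ℝ) ^ ((1 : ℝ) / n) * (n : ℝ) ^ ((1 : ℝ) / n)) * Real.exp (-1)) atTop
      (𝓝 (Real.exp (-1))) := by
    simpa using (h1.mul (h2.mul h3).sqrt).mul_const (Real.exp (-1))
  refine h4.congr' ?_
  filter_upwards [eventually_gt_atTop 0] with n hn
  have hn' : (0 : ℝ) < n := by exact_mod_cast hn
  have hfac : (n.factorial : ℝ) = Stirling.stirlingSeq n * √(2 * n) * (n / Real.exp 1) ^ n := by
    rw [Stirling.stirlingSeq]
    field_simp
  have hs : 0 ≤ Stirling.stirlingSeq n := by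
    rw [Stirling.stirlingSeq]
    positivity
  have hroot : ((n / Real.exp 1) ^ n) ^ ((1 : ℝ) / n) = n / Real.exp 1 := by
    rw [one_div]
    exact Real.pow_rpow_inv_natCast (by positivity) hn.ne'
  have hsqrt : √(2 * n) ^ ((1 : ℝ) / n) = √((2 : ℝ) ^ ((1 : ℝ) / n) * (n : ℝ) ^ ((1 : ℝ) / n)) := by
    rw [← Real.mul_rpow (by positivity) (by positivity), Real.sqrt_eq_rpow, Real.sqrt_eq_rpow,
      ← Real.rpow_mul (by positivity), ← Real.rpow_mul (by positivity), mul_comm (1 / 2 : ℝ)]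
  rw [hfac, Real.mul_rpow (by positivity) (by positivity), Real.mul_rpow hs (by positivity),
    hroot, hsqrt, Real.exp_neg]
  field_simp

/-- Binomial coefficients at `a` and `a + c` when `a + c` is at most the reflected index. -/
theorem choose_le_choose_add {n a c : ℕ} (h : 2 * a + c ≤ n) :
    n.choose a ≤ n.choose (a + c) := by
  have key := Nat.choose_mul (n := n) (k := a + c) (s := a) (Nat.le_add_right a c)
  rw [Nat.add_sub_cancel_left, Nat.choose_symm_add] at key
  have h1 : (a + c).choose c ≤ (n - a).choose c := Nat.choose_le_choose c (by omega)
  have h2 : 0 < (a + c).choose c := Nat.choose_pos (by omega)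
  refine Nat.le_of_mul_le_mul_right ?_ h2
  rw [key]
  exact Nat.mul_le_mul_left _ h1

theorem choose_add_mul_pow_le (n a c : ℕ) :
    n.choose (a + c) * a ^ c ≤ n.choose a * (n - a) ^ c := by
  have key := Nat.choose_mul (n := n) (k := a + c) (s := a) (Nat.le_add_right a c)
  rw [Nat.add_sub_cancel_left, Nat.choose_symm_add] at key
  have h1 : a ^ c ≤ c.factorial * (a + c).choose c := by
    rw [← Nat.descFactorial_eq_factorial_mul_choose]
    refine le_trans (Nat.pow_le_pow_left ?_ c) (Nat.pow_sub_le_descFactorial (a + c) c)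
    omega
  have h2 : c.factorial * (n - a).choose c ≤ (n - a) ^ c := by
    rw [← Nat.descFactorial_eq_factorial_mul_choose]
    exact Nat.descFactorial_le_pow (n - a) c
  calc n.choose (a + c) * a ^ c
      ≤ n.choose (a + c) * (c.factorial * (a + c).choose c) := Nat.mul_le_mul_left _ h1
    _ = n.choose a * (c.factorial * (n - a).choose c) := by
      rw [mul_left_comm, key, mul_left_comm]
    _ ≤ n.choose a * (n - a) ^ c := Nat.mul_le_mul_left _ h2

theorem choose_add_div_rpow_le {n a c : ℕ} (ha : 0 < a) (h : a < n) :
    (n.choose (a + c) : ℝ) / (n.choose a : ℝ) ^ (((a : ℝ) + c) / a) ≤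
      ((a.factorial : ℝ) ^ ((1 : ℝ) / a) / a) ^ c := by
  have ha' : (0 : ℝ) < a := by exact_mod_cast ha
  have hK : (0 : ℝ) < n.choose a := by exact_mod_cast Nat.choose_pos h.le
  have hd : (0 : ℝ) < ((n - a : ℕ) : ℝ) := by exact_mod_cast Nat.sub_pos_of_lt h
  have hpow : (n.choose a : ℝ) ^ (((a : ℝ) + c) / a) =
      n.choose a * ((n.choose a : ℝ) ^ ((1 : ℝ) / a)) ^ c := by
    rw [add_div, div_self ha'.ne', Real.rpow_add hK, Real.rpow_one, ← Real.rpow_natCast,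
      ← Real.rpow_mul hK.le, one_div_mul_eq_div]
  have hF : (n.choose (a + c) : ℝ) * (a : ℝ) ^ c ≤ n.choose a * ((n - a : ℕ) : ℝ) ^ c := by
    exact_mod_cast choose_add_mul_pow_le n a c
  have hlow : ((n - a : ℕ) : ℝ) ^ a ≤ a.factorial * n.choose a := by
    rw [← Nat.cast_pow, ← Nat.cast_mul, ← Nat.descFactorial_eq_factorial_mul_choose]
    exact_mod_cast (Nat.pow_le_pow_left (by omega) a).trans (Nat.pow_sub_le_descFactorial n a)
  have hroot : ((n - a : ℕ) : ℝ) ≤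
      (a.factorial : ℝ) ^ ((1 : ℝ) / a) * (n.choose a : ℝ) ^ ((1 : ℝ) / a) := by
    rw [← Real.mul_rpow (by positivity) hK.le]
    calc ((n - a : ℕ) : ℝ) = (((n - a : ℕ) : ℝ) ^ a) ^ ((1 : ℝ) / a) := by
          rw [one_div, Real.pow_rpow_inv_natCast hd.le ha.ne']
      _ ≤ _ := Real.rpow_le_rpow (by positivity) hlow (by positivity)
  rw [hpow, div_pow, div_le_div_iff₀ (by positivity) (by positivity)]
  calc (n.choose (a + c) : ℝ) * (a : ℝ) ^ c ≤ n.choose a * ((n - a : ℕ) : ℝ) ^ c := hF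
    _ ≤ n.choose a * ((a.factorial : ℝ) ^ ((1 : ℝ) / a) *
        (n.choose a : ℝ) ^ ((1 : ℝ) / a)) ^ c := by gcongr
    _ = _ := by ring

open Filter in
theorem tendsto_ceil_log_pow_atTop {c : ℕ} (hc : c ≠ 0) :
    Tendsto (fun n : ℕ => ⌈(Real.log n) ^ c⌉₊) atTop atTop :=
  tendsto_nat_ceil_atTop.comp <| (tendsto_pow_atTop hc).comp <|
    Real.tendsto_log_atTop.comp tendsto_natCast_atTop_atTop

open Filter in
theorem eventually_two_mul_ceil_log_pow_add_le (c d : ℕ) :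
    ∀ᶠ n : ℕ in atTop, 2 * ⌈(Real.log n) ^ c⌉₊ + d ≤ n := by
  have h := (Real.isLittleO_pow_log_id_atTop (n := c)).comp_tendsto
    (tendsto_natCast_atTop_atTop (R := ℝ))
  filter_upwards [h.def (c := 1 / 4) (by norm_num), eventually_ge_atTop (2 * (d + 2))] with n hn hd
  have hd' : (2 * (d + 2) : ℝ) ≤ n := by exact_mod_cast hd
  simp only [Function.comp_apply, id_eq, Real.norm_eq_abs, Nat.abs_cast] at hn
  have hlog : 0 ≤ Real.log n ^ c := pow_nonneg (Real.log_natCast_nonneg n) c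
  rw [abs_of_nonneg hlog] at hn
  have hceil := Nat.ceil_lt_add_one hlog
  have : (2 * ⌈(Real.log n) ^ c⌉₊ + d : ℝ) ≤ n := by linarith
  exact_mod_cast this

/-- With `a(n) = ⌈(log n)^c⌉`, `b(n) = n − a(n) − c`, `F(n) = C(n,b(n))` and
`K(n) = C(n,a(n))`: (i) `F(n) ≥ K(n)` for all sufficiently large `n`, and
(ii) `limsup F(n)/K(n)^{(a(n)+c)/a(n)} ≤ e^{−c} < 1`. -/
theorem stmt_16 (c : ℕ) (hc : 2 ≤ c) (a b : ℕ → ℕ)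
    (ha : ∀ n, a n = ⌈(Real.log n) ^ c⌉₊) (hb : ∀ n, b n = n - a n - c)
    (F K : ℕ → ℕ) (hF : ∀ n, F n = Nat.choose n (b n)) (hK : ∀ n, K n = Nat.choose n (a n)) :
    (∀ᶠ n in Filter.atTop, K n ≤ F n) ∧
    Filter.limsup
        (fun n => (F n : ℝ) / (K n : ℝ) ^ (((a n : ℝ) + (c : ℝ)) / (a n : ℝ)))
        Filter.atTop ≤ Real.exp (-(c : ℝ)) ∧
    Real.exp (-(c : ℝ)) < 1 := by
  have hlarge : ∀ᶠ n in Filter.atTop, 2 * a n + c ≤ n := by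
    simpa only [ha] using eventually_two_mul_ceil_log_pow_add_le c c
  have hatop : Filter.Tendsto a Filter.atTop Filter.atTop := by
    simpa only [← ha] using tendsto_ceil_log_pow_atTop (c := c) (by omega)
  have hF' : ∀ n, 2 * a n + c ≤ n → F n = n.choose (a n + c) := fun n hn => by
    rw [hF, hb, Nat.sub_sub, Nat.choose_symm (by omega)]
  refine ⟨?_, ?_, ?_⟩
  · filter_upwards [hlarge] with n hn
    rw [hF' n hn, hK]
    exact choose_le_choose_add hn
  · have hlim : Filter.Tendsto
        (fun n => (((a n).factorial : ℝ) ^ ((1 : ℝ) / a n) / a n) ^ c) Filter.atTop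
        (nhds (Real.exp (-(c : ℝ)))) := by
      have h := (tendsto_factorial_rpow_inv_div.comp hatop).pow c
      rwa [← Real.exp_nat_mul, mul_neg_one] at h
    rw [← hlim.limsup_eq]
    refine Filter.limsup_le_limsup ?_ ?_ hlim.isBoundedUnder_le
    · filter_upwards [hlarge, hatop.eventually_gt_atTop 0] with n hn hpos
      rw [hF' n hn, hK]
      exact choose_add_div_rpow_le hpos (by omega)
    · exact Filter.isCoboundedUnder_le_of_le Filter.atTop (x := 0) fun n => by positivity
  · rw [Real.exp_lt_one_iff, neg_lt_zero]
    exact_mod_cast (by omega : 0 < c)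
end

section
/- Fix an integer c ≥ 2. For each integer n large enough that ⌈(log n)^c⌉ + c ≤ n, set a(n) = ⌈(log n)^c⌉ (natural logarithm) and b(n) = n − a(n) − c, and define F(n) = C(n, b(n)) and F*(n) = C( C(n, a(n)), C(n − b(n), a(n)) ). Then log F*(n) / (log F(n))^c → ∞ as n → ∞. -/
/-- If `4 r² ≤ m` then `C(m, r) ≥ (√m) ^ r`, in logarithmic form. -/
theorem mul_log_div_two_le_log_choose {m r : ℕ} (hr : 1 ≤ r) (h : 4 * r ^ 2 ≤ m) :
    r * (Real.log m / 2) ≤ Real.log (m.choose r) := by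
  have hr' : (1 : ℝ) ≤ r := by exact_mod_cast hr
  have hm : 4 * (r : ℝ) ^ 2 ≤ m := by exact_mod_cast h
  have hm0 : (0 : ℝ) < m := by nlinarith
  have hs : 2 * (r : ℝ) ≤ √m := Real.le_sqrt_of_sq_le (by linarith)
  have hss : √(m : ℝ) * √m = m := Real.mul_self_sqrt hm0.le
  have hs0 : 0 < √(m : ℝ) := Real.sqrt_pos.2 hm0
  have hrm : r ≤ m + 1 := by nlinarith
  have key : (√(m : ℝ)) ^ r ≤ m.choose r := by
    refine le_trans ?_ (Nat.pow_le_choose (α := ℝ) r m)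
    rw [le_div_iff₀ (by positivity)]
    calc (√(m : ℝ)) ^ r * (r.factorial : ℝ) ≤ (√(m : ℝ)) ^ r * (r : ℝ) ^ r := by
          gcongr
          exact_mod_cast Nat.factorial_le_pow r
      _ = (√(m : ℝ) * r) ^ r := by rw [mul_pow]
      _ ≤ _ := by
          gcongr
          rw [Nat.cast_sub hrm]
          push_cast
          nlinarith
  calc r * (Real.log m / 2) = Real.log ((√(m : ℝ)) ^ r) := by
        rw [Real.log_pow, Real.log_sqrt hm0.le]
    _ ≤ _ := Real.log_le_log (by positivity) key

theorem eventually_mul_log_pow_le (K : ℝ) (p : ℕ) :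
    ∀ᶠ n : ℕ in Filter.atTop, K * Real.log n ^ p ≤ n := by
  have h := ((Real.isLittleO_pow_log_id_atTop (n := p)).const_mul_left K).comp_tendsto
    (tendsto_natCast_atTop_atTop (R := ℝ))
  filter_upwards [h.bound one_pos] with n hn
  simp only [Function.comp, id, Real.norm_eq_abs, one_mul, Nat.abs_cast] at hn
  exact (le_abs_self _).trans hn

/-- With `a(n) = ⌈(log n)^c⌉`, `b(n) = n − a(n) − c`, `F(n) = C(n,b(n))` and
`F*(n) = C(C(n,a(n)), C(n−b(n),a(n)))`, one has `log F*(n) / (log F(n))^c → ∞`. -/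
theorem stmt_17 (c : ℕ) (hc : 2 ≤ c) (a b : ℕ → ℕ)
    (ha : ∀ n, a n = ⌈(Real.log n) ^ c⌉₊) (hb : ∀ n, b n = n - a n - c)
    (F Fstar : ℕ → ℕ) (hF : ∀ n, F n = Nat.choose n (b n))
    (hFs : ∀ n, Fstar n = Nat.choose (Nat.choose n (a n)) (Nat.choose (n - b n) (a n))) :
    Filter.Tendsto (fun n => Real.log (Fstar n) / (Real.log (F n)) ^ c)
      Filter.atTop Filter.atTop := by
  have hL : Filter.Tendsto (fun n : ℕ => Real.log n) Filter.atTop Filter.atTop :=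
    Real.tendsto_log_atTop.comp tendsto_natCast_atTop_atTop
  have hmain : Filter.Tendsto (fun n : ℕ => Real.log n / (4 * c.factorial * 3 ^ c))
      Filter.atTop Filter.atTop := hL.atTop_div_const (by positivity)
  refine Filter.tendsto_atTop_mono' _ ?_ hmain
  filter_upwards [hL.eventually_ge_atTop (c : ℝ), eventually_mul_log_pow_le 16 (c * 2),
    eventually_mul_log_pow_le 4 c,
    eventually_mul_log_pow_le (4 * (3 ^ c) ^ 2) (c * c * 2)] with n hLc h1 h2 h3
  have hc' : (2 : ℝ) ≤ c := by exact_mod_cast hc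
  set L := Real.log n with hLdef
  have hL1 : 1 ≤ L := by linarith
  have hLpow : L ≤ L ^ c := le_self_pow₀ hL1 (by omega)
  have haL : L ^ c ≤ a n := by rw [ha]; exact Nat.le_ceil _
  have haU : (a n : ℝ) < L ^ c + 1 := by rw [ha]; exact Nat.ceil_lt_add_one (by positivity)
  have hacU : ((a n + c : ℕ) : ℝ) ≤ 3 * L ^ c := by push_cast; linarith
  have ha2 : 2 ≤ a n := by
    have : (2 : ℝ) ≤ a n := by linarith
    exact_mod_cast this
  have hacn : a n + c < n := by
    have : ((a n + c : ℕ) : ℝ) < n := by linarith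
    exact_mod_cast this
  have hnb : n - b n = a n + c := by rw [hb]; omega
  have hn0 : (0 : ℝ) < n := by linarith
  have hFeq : F n = n.choose (a n + c) := by
    rw [hF, ← hnb, Nat.choose_symm (by rw [hb]; omega)]
  have hFpos : 0 < Real.log (F n) := by
    apply Real.log_pos
    rw [hFeq]
    have : 1 < n.choose (a n + c) := by
      have hpos : 0 < n.choose (a n + c) := Nat.choose_pos hacn.le
      have hne : n.choose (a n + c) ≠ 1 := by
        rw [Ne, Nat.choose_eq_one_iff]
        omega
      omega
    exact_mod_cast this
  have hFle : Real.log (F n) ≤ 3 * L ^ (c + 1) := by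
    have hF0 : (0 : ℝ) < F n := by
      rw [hFeq]; exact_mod_cast Nat.choose_pos hacn.le
    have h : (F n : ℝ) ≤ (n : ℝ) ^ (a n + c) := by
      rw [hFeq]; exact_mod_cast Nat.choose_le_pow _ _
    calc Real.log (F n) ≤ Real.log ((n : ℝ) ^ (a n + c)) :=
          Real.log_le_log hF0 h
      _ = ((a n + c : ℕ) : ℝ) * L := by rw [Real.log_pow]
      _ ≤ 3 * L ^ c * L := by gcongr
      _ = _ := by ring
  have hMlog : a n * (L / 2) ≤ Real.log (n.choose (a n)) := by
    apply mul_log_div_two_le_log_choose (by omega)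
    have : 4 * (a n : ℝ) ^ 2 ≤ n := by
      calc 4 * (a n : ℝ) ^ 2 ≤ 4 * (2 * L ^ c) ^ 2 := by gcongr; linarith
        _ = 16 * L ^ (c * 2) := by ring
        _ ≤ n := h1
    exact_mod_cast this
  have hMn : n ≤ n.choose (a n) := by
    have hMpos : (0 : ℝ) < n.choose (a n) := by
      exact_mod_cast Nat.choose_pos (by omega)
    have : L ≤ Real.log (n.choose (a n)) := by
      refine le_trans ?_ hMlog
      have : (2 : ℝ) ≤ a n := by exact_mod_cast ha2
      nlinarith
    exact_mod_cast (Real.log_le_log_iff hn0 hMpos).1 this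
  set k := (a n + c).choose (a n) with hk
  have hkc : k = (a n + c).choose c := Nat.choose_symm_add
  have hkU : (k : ℝ) ≤ 3 ^ c * L ^ (c * c) := by
    calc (k : ℝ) ≤ ((a n + c : ℕ) : ℝ) ^ c := by
          rw [hkc]; exact_mod_cast Nat.choose_le_pow _ _
      _ ≤ (3 * L ^ c) ^ c := by gcongr
      _ = _ := by rw [mul_pow, pow_mul]
  have hkL : L ^ (c * c) / c.factorial ≤ k := by
    rw [hkc]
    refine le_trans ?_ (Nat.pow_le_choose (α := ℝ) c (a n + c))
    rw [pow_mul]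
    gcongr
    rw [show a n + c + 1 - c = a n + 1 by omega]
    push_cast
    linarith
  have hk1 : 1 ≤ k := Nat.choose_pos (by omega)
  have hFsL : k * (Real.log (n.choose (a n)) / 2) ≤ Real.log (Fstar n) := by
    rw [hFs, hnb]
    apply mul_log_div_two_le_log_choose hk1
    refine le_trans ?_ hMn
    have : 4 * (k : ℝ) ^ 2 ≤ n := by
      calc 4 * (k : ℝ) ^ 2 ≤ 4 * (3 ^ c * L ^ (c * c)) ^ 2 := by gcongr
        _ = 4 * (3 ^ c) ^ 2 * L ^ (c * c * 2) := by rw [mul_pow, ← pow_mul L]; ring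
        _ ≤ n := h3
    exact_mod_cast this
  have hpos : 0 < Real.log (F n) ^ c := by positivity
  rw [le_div_iff₀ hpos]
  calc L / (4 * c.factorial * 3 ^ c) * Real.log (F n) ^ c
      ≤ L / (4 * c.factorial * 3 ^ c) * (3 * L ^ (c + 1)) ^ c := by gcongr
    _ = L ^ (c * c) / c.factorial * (L ^ c * (L / 2) / 2) := by
        rw [mul_pow, ← pow_mul, add_mul, pow_add, one_mul]
        field_simp
        ring
    _ ≤ k * (a n * (L / 2) / 2) := by gcongr
    _ ≤ k * (Real.log (n.choose (a n)) / 2) := by gcongr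
    _ ≤ _ := hFsL
end
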